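/- Let n ≥ 3 be an odd integer, set m = (n−3)/2, and let 0 < ε < 1. Then there is a constant C = C(n, ε) such that for every N ≥ 2, all real s₁, …, s_N with m ≤ s_j ≤ m + 1 − ε for each j, every γ > 0 and every ξ ∈ ℝⁿ, T_{N,γ}(ξ; s₁, …, s_N) ≤ C^{N-1} γ^{-(N-1)} ⟨ξ⟩^{2((N-1)m − s₁ − ⋯ − s_N)}. -/

import Mathlib

open MeasureTheory Finset

/-- `hfun γ r s = (γ + |r-s|)⁻¹ (γ + |r+s|)⁻¹`. -/
noncomputable def hfun (γ r s : ℝ) : ℝ := (γ + |r - s|)⁻¹ * (γ + |r + s|)⁻¹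

/-- The Japanese bracket `⟨x⟩ = (1 + |x|²)^{1/2}` of a vector. -/
noncomputable def jap {E : Type*} [NormedAddCommGroup E] (x : E) : ℝ :=
  Real.sqrt (1 + ‖x‖ ^ 2)

/-- `Mfun N s ξ = ⟨ξ₀+ξ_{N-1}⟩^{-s₀} ⟨ξ₁-ξ₀⟩^{-s₁} ⋯ ⟨ξ_{N-1}-ξ_{N-2}⟩^{-s_{N-1}}`
(the function `M_{s₁,…,s_N}(ξ₁,…,ξ_N)` of the paper, with indices shifted to start at `0`). -/
noncomputable def Mfun {E : Type*} [NormedAddCommGroup E] (N : ℕ) (s : ℕ → ℝ) (ξ : ℕ → E) : ℝ :=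
  jap (ξ 0 + ξ (N - 1)) ^ (-(s 0)) * ∏ j ∈ Finset.Ico 1 N, jap (ξ j - ξ (j - 1)) ^ (-(s j))

/-- `Tfun n N γ ξ s = ∫_{(ℝⁿ)^{N-1}} (∏_j h_γ(|ξ_j|,|ξ|))² M_s(ξ₁,…,ξ_{N-1},ξ)² dξ₁⋯dξ_{N-1}`. -/
noncomputable def Tfun (n N : ℕ) (γ : ℝ) (ξ : EuclideanSpace ℝ (Fin n)) (s : ℕ → ℝ) : ℝ :=
  ∫ y : Fin (N - 1) → EuclideanSpace ℝ (Fin n),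
    (∏ j : Fin (N - 1), hfun γ ‖y j‖ ‖ξ‖) ^ 2 *
      Mfun N s (fun j => if h : j < N - 1 then y ⟨j, h⟩ else ξ) ^ 2

open scoped ENNReal NNReal Pointwise

/-- Euclidean space of dimension `n + 1`. -/
abbrev EE (n : ℕ) : Type := EuclideanSpace ℝ (Fin (n + 1))

section SphereLemmas
variable {n : ℕ}

lemma cap_bound (v : EE n) (δ : ℝ) (hδ : 0 < δ) (hδ1 : δ ≤ 1) :
    (volume : Measure (EE n)).toSphere {ω | ‖(ω : EE n) - v‖ ≤ δ}
      ≤ ENNReal.ofReal (δ ^ n) * (((n + 1 : ℕ) : ℝ≥0∞) * (ENNReal.ofReal (2 ^ (n + 2)) *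
        volume (Metric.closedBall (0 : EE n) 1))) := by
  have hms : MeasurableSet {ω : Metric.sphere (0 : EE n) 1 | ‖(ω : EE n) - v‖ ≤ δ} := by
    apply measurableSet_le
    · fun_prop
    · fun_prop
  rw [Measure.toSphere_apply' _ hms]
  set M : ℕ := ⌈1 / δ⌉₊ with hM
  have hMδ : 1 / δ ≤ M := Nat.le_ceil _
  have hMpos : (0 : ℝ) < M := lt_of_lt_of_le (by positivity) hMδ
  have hM2 : (M : ℝ) ≤ 2 / δ := by
    have := Nat.ceil_lt_add_one (a := 1 / δ) (by positivity)
    have h1 : 1 ≤ 1 / δ := by rw [le_div_iff₀ hδ]; linarith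
    have : (2 : ℝ) / δ = 1 / δ + 1 / δ := by ring
    linarith
  have hMinv : 1 / (M : ℝ) ≤ δ := by
    rw [div_le_iff₀ hMpos]; rw [div_le_iff₀ hδ] at hMδ; linarith
  have hsub : (Set.Ioo (0 : ℝ) 1 • ((↑) '' {ω : Metric.sphere (0 : EE n) 1 | ‖(ω : EE n) - v‖ ≤ δ}) : Set (EE n))
      ⊆ ⋃ i ∈ Finset.range M, Metric.closedBall (((i : ℝ) / M) • v) (2 * δ) := by
    rintro y hy
    obtain ⟨r, ⟨hr0, hr1⟩, _, ⟨ω, hω, rfl⟩, rfl⟩ := Set.mem_smul.1 hy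
    have hω' : ‖(ω : EE n) - v‖ ≤ δ := hω
    have hωn : ‖(ω : EE n)‖ = 1 := by simp
    simp only [Set.mem_iUnion]
    refine ⟨⌊r * M⌋₊, ?_, ?_⟩
    · rw [Finset.mem_range, Nat.floor_lt (by positivity)]
      nlinarith
    · have hf1 : (⌊r * M⌋₊ : ℝ) ≤ r * M := Nat.floor_le (by positivity)
      have hf2 : r * M < ⌊r * M⌋₊ + 1 := Nat.lt_floor_add_one _
      set q : ℝ := (⌊r * M⌋₊ : ℝ) / M with hq
      have hq0 : 0 ≤ q := by positivity
      have hq1 : q ≤ r := by rw [hq, div_le_iff₀ hMpos]; exact hf1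
      have hq2 : r - q ≤ δ := by
        refine le_trans ?_ hMinv
        rw [hq, sub_le_iff_le_add, ← add_div, le_div_iff₀ hMpos]; linarith
      rw [Metric.mem_closedBall, dist_eq_norm]
      have : r • (ω : EE n) - q • v = (r - q) • (ω : EE n) + q • ((ω : EE n) - v) := by
        rw [sub_smul, smul_sub]; abel
      rw [this]
      calc _ ≤ ‖(r - q) • (ω : EE n)‖ + ‖q • ((ω : EE n) - v)‖ := norm_add_le _ _
        _ = (r - q) + q * ‖(ω : EE n) - v‖ := by
          rw [norm_smul, norm_smul, hωn, Real.norm_of_nonneg hq0, Real.norm_of_nonneg (by linarith)]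
          ring
        _ ≤ δ + 1 * δ := by
          gcongr; linarith
        _ = 2 * δ := by ring
  have hdim : Module.finrank ℝ (EE n) = n + 1 := by simp
  have hvol : volume (Set.Ioo (0 : ℝ) 1 • ((↑) '' {ω : Metric.sphere (0 : EE n) 1 | ‖(ω : EE n) - v‖ ≤ δ}) : Set (EE n))
      ≤ ENNReal.ofReal (δ ^ n) * (ENNReal.ofReal (2 ^ (n + 2)) * volume (Metric.closedBall (0 : EE n) 1)) := by
    calc _ ≤ volume (⋃ i ∈ Finset.range M, Metric.closedBall (((i : ℝ) / M) • v) (2 * δ)) :=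
          measure_mono hsub
      _ ≤ ∑ i ∈ Finset.range M, volume (Metric.closedBall (((i : ℝ) / M) • v) (2 * δ)) :=
          measure_biUnion_finset_le _ _
      _ = ENNReal.ofReal (M * (2 * δ) ^ (n + 1)) * volume (Metric.closedBall (0 : EE n) 1) := by
          simp_rw [Measure.addHaar_closedBall' volume _ (show (0 : ℝ) ≤ 2 * δ by positivity), hdim]
          rw [Finset.sum_const, Finset.card_range, nsmul_eq_mul, ENNReal.ofReal_mul (by positivity),
            mul_assoc, ENNReal.ofReal_natCast]
      _ ≤ ENNReal.ofReal (δ ^ n * 2 ^ (n + 2)) * volume (Metric.closedBall (0 : EE n) 1) := by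
          refine mul_le_mul_left (ENNReal.ofReal_le_ofReal ?_) _
          calc (M : ℝ) * (2 * δ) ^ (n + 1) ≤ 2 / δ * (2 * δ) ^ (n + 1) := by gcongr
            _ = δ ^ n * 2 ^ (n + 2) := by
              rw [mul_pow, pow_succ δ n]; field_simp; ring
      _ = _ := by rw [ENNReal.ofReal_mul (by positivity), mul_assoc]
  rw [hdim]
  calc _ ≤ ((n + 1 : ℕ) : ℝ≥0∞) * _ := mul_le_mul_right hvol _
    _ = _ := by ring

/-- dyadic majorant -/
noncomputable def Gmaj (p t : ℝ) : ℝ≥0∞ :=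
  1 + ∑' j : ℕ, ENNReal.ofReal ((2 : ℝ) ^ (((j : ℝ) + 1) * p)) *
    Set.indicator (Set.Iic ((1 / 2 : ℝ) ^ j)) (fun _ => (1 : ℝ≥0∞)) t

lemma le_Gmaj (p q t u : ℝ) (hq : 0 ≤ q) (hqp : q ≤ p) (htu : t ≤ u) (hu : 0 < u) :
    ENNReal.ofReal (u ^ (-q)) ≤ Gmaj p t := by
  unfold Gmaj
  rcases le_total 1 u with h1 | h1
  · refine le_trans ?_ le_self_add
    rw [← ENNReal.ofReal_one]
    apply ENNReal.ofReal_le_ofReal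
    exact Real.rpow_le_one_of_one_le_of_nonpos h1 (by linarith)
  · obtain ⟨j, hj1, hj2⟩ := exists_nat_pow_near_of_lt_one hu h1 (show (0 : ℝ) < 1 / 2 by norm_num) (by norm_num)
    refine le_trans ?_ le_add_self
    refine le_trans ?_ (ENNReal.le_tsum j)
    rw [Set.indicator_of_mem (by exact htu.trans hj2), mul_one]
    apply ENNReal.ofReal_le_ofReal
    calc u ^ (-q) ≤ u ^ (-p) := Real.rpow_le_rpow_of_exponent_ge hu h1 (by linarith)
      _ ≤ ((1 / 2 : ℝ) ^ (j + 1)) ^ (-p) :=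
        Real.rpow_le_rpow_of_nonpos (by positivity) hj1.le (by linarith)
      _ = _ := by
        rw [← Real.rpow_natCast, ← Real.rpow_mul (by norm_num), one_div, Real.inv_rpow (by norm_num),
          ← Real.rpow_neg (by norm_num)]
        push_cast; ring_nf

lemma sphere_G (p : ℝ) (hp : p < n) : ∃ C : ℝ≥0∞, C ≠ ∞ ∧
    ∀ v : EE n,
      ∫⁻ ω, Gmaj p ‖(ω : EE n) - v‖
        ∂(volume : Measure (EE n)).toSphere ≤ C := by
  set σ := (volume : Measure (EE n)).toSphere
  set K : ℝ≥0∞ := (((n + 1 : ℕ) : ℝ≥0∞) * (ENNReal.ofReal (2 ^ (n + 2)) *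
        volume (Metric.closedBall (0 : EE n) 1))) with hK
  have hKtop : K ≠ ∞ := by
    rw [hK]
    refine ENNReal.mul_ne_top (by simp) (ENNReal.mul_ne_top (by simp) ?_)
    exact measure_closedBall_lt_top.ne
  set θ : ℝ := (2 : ℝ) ^ (p - n) with hθ
  have hθ0 : 0 < θ := by positivity
  have hθ1 : θ < 1 := Real.rpow_lt_one_of_one_lt_of_neg (by norm_num) (by linarith)
  refine ⟨σ Set.univ + ENNReal.ofReal (2 ^ p) * (∑' j : ℕ, ENNReal.ofReal θ ^ j) * K, ?_, ?_⟩
  · refine ENNReal.add_ne_top.2 ⟨measure_ne_top _ _, ENNReal.mul_ne_top (ENNReal.mul_ne_top (by simp) ?_) hKtop⟩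
    rw [ENNReal.tsum_geometric]
    simp [tsub_eq_zero_iff_le, hθ1]
  · intro v
    have hm : Measurable fun ω : Metric.sphere (0 : EE n) 1 => ‖(ω : EE n) - v‖ := by fun_prop
    have hmj : ∀ j : ℕ, Measurable fun ω : Metric.sphere (0 : EE n) 1 =>
        Set.indicator (Set.Iic ((1 / 2 : ℝ) ^ j)) (fun _ => (1 : ℝ≥0∞)) ‖(ω : EE n) - v‖ := fun j =>
      (measurable_const.indicator measurableSet_Iic).comp hm
    unfold Gmaj
    rw [lintegral_add_left measurable_const, lintegral_tsum (fun j => ((hmj j).const_mul _).aemeasurable)]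
    simp only [lintegral_const, one_mul]
    gcongr
    rw [← ENNReal.tsum_mul_left, ← ENNReal.tsum_mul_right]
    refine ENNReal.tsum_le_tsum fun j => ?_
    rw [lintegral_const_mul _ (hmj j)]
    have : ∫⁻ ω : Metric.sphere (0 : EE n) 1, Set.indicator (Set.Iic ((1 / 2 : ℝ) ^ j)) (fun _ => (1 : ℝ≥0∞)) ‖(ω : EE n) - v‖ ∂σ
        = σ {ω | ‖(ω : EE n) - v‖ ≤ (1 / 2 : ℝ) ^ j} := by
      exact lintegral_indicator_one (hm measurableSet_Iic)
    rw [this]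
    calc _ ≤ ENNReal.ofReal ((2 : ℝ) ^ (((j : ℝ) + 1) * p)) * (ENNReal.ofReal (((1 / 2 : ℝ) ^ j) ^ n) * K) := by
          gcongr
          exact cap_bound v _ (by positivity) (pow_le_one₀ (by norm_num) (by norm_num))
      _ = _ := by
          rw [← mul_assoc, ← ENNReal.ofReal_pow hθ0.le, ← ENNReal.ofReal_mul (by positivity),
            ← ENNReal.ofReal_mul (by positivity)]
          congr 2
          rw [hθ, ← Real.rpow_natCast, ← Real.rpow_natCast, ← Real.rpow_natCast, one_div,
            Real.inv_rpow (by norm_num), Real.inv_rpow (by positivity), ← Real.rpow_mul (by norm_num),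
            ← Real.rpow_mul (by norm_num), ← Real.rpow_neg (by norm_num),
            ← Real.rpow_add (by norm_num), ← Real.rpow_add (by norm_num)]
          congr 1; ring

lemma polar (F : EE n → ℝ≥0∞) (hF : Measurable F) :
    ∫⁻ y, F y = ∫⁻ r in Set.Ioi (0 : ℝ), ENNReal.ofReal (r ^ n) *
      ∫⁻ ω, F (r • (ω : EE n))
        ∂(volume : Measure (EE n)).toSphere := by
  have hdim : Module.finrank ℝ (EE n) = n + 1 := by simp
  have hmp := (volume : Measure (EE n)).measurePreserving_homeomorphUnitSphereProd
  rw [hdim, Nat.add_sub_cancel] at hmp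
  have h1 : ∫⁻ y, F y = ∫⁻ y : ({0}ᶜ : Set (EE n)), F y ∂((volume : Measure (EE n)).comap (↑)) := by
    rw [lintegral_subtype_comap (measurableSet_singleton _).compl, restrict_compl_singleton]
  have h2 : ∫⁻ y : ({0}ᶜ : Set (EE n)), F y ∂((volume : Measure (EE n)).comap (↑)) =
      ∫⁻ z, F ((z.2 : ℝ) • (z.1 : EE n)) ∂((volume : Measure (EE n)).toSphere.prod (Measure.volumeIoiPow n)) := by
    rw [← hmp.lintegral_comp_emb (Homeomorph.measurableEmbedding _)]
    refine lintegral_congr fun y => ?_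
    congr 1
    have hy : ‖(y : EE n)‖ ≠ 0 := norm_ne_zero_iff.2 y.2
    simp [smul_smul, hy]
  have hFm : Measurable fun z : Metric.sphere (0 : EE n) 1 × Set.Ioi (0 : ℝ) => F ((z.2 : ℝ) • (z.1 : EE n)) := by
    exact hF.comp (by fun_prop)
  rw [h1, h2, lintegral_prod_symm _ hFm.aemeasurable, Measure.volumeIoiPow,
    lintegral_withDensity_eq_lintegral_mul _ (by fun_prop)]
  · rw [← lintegral_subtype_comap measurableSet_Ioi]
    rfl
  · exact Measurable.lintegral_prod_left' hFm

end SphereLemmas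

lemma oneD (γ k : ℝ) (hγ : 0 < γ) :
    ∫⁻ r : ℝ, ENNReal.ofReal ((γ + |r - k|)⁻¹ ^ 2) ≤ ENNReal.ofReal (Real.pi * γ⁻¹) := by
  have h0 : ∫⁻ r : ℝ, ENNReal.ofReal ((γ + |r - k|)⁻¹ ^ 2) =
      ∫⁻ r : ℝ, ENNReal.ofReal ((γ + |r|)⁻¹ ^ 2) :=
    lintegral_sub_right_eq_self (fun r => ENNReal.ofReal ((γ + |r|)⁻¹ ^ 2)) k
  rw [h0]
  have hIntg : Integrable fun x : ℝ => γ⁻¹ ^ 2 * (1 + (x / γ) ^ 2)⁻¹ :=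
    (integrable_inv_one_add_sq.comp_div hγ.ne').const_mul _
  calc _ ≤ ∫⁻ r : ℝ, ENNReal.ofReal (γ⁻¹ ^ 2 * (1 + (r / γ) ^ 2)⁻¹) := by
        refine lintegral_mono fun r => ENNReal.ofReal_le_ofReal ?_
        rw [inv_pow, inv_pow, ← mul_inv]
        · apply inv_anti₀ (by positivity)
          have : γ ^ 2 * (1 + (r / γ) ^ 2) = γ ^ 2 + |r| ^ 2 := by
            rw [sq_abs]; field_simp
          rw [this]
          nlinarith [abs_nonneg r, mul_nonneg hγ.le (abs_nonneg r)]
    _ = ENNReal.ofReal (∫ r : ℝ, γ⁻¹ ^ 2 * (1 + (r / γ) ^ 2)⁻¹) := by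
        rw [ofReal_integral_eq_lintegral_ofReal hIntg]
        exact Filter.Eventually.of_forall fun x => by positivity
    _ ≤ _ := by
        apply ENNReal.ofReal_le_ofReal
        rw [integral_const_mul, Measure.integral_comp_div (fun x => (1 + x ^ 2)⁻¹) γ,
          integral_univ_inv_one_add_sq, smul_eq_mul, abs_of_pos hγ]
        apply le_of_eq
        field_simp

lemma jap_pos {E : Type*} [NormedAddCommGroup E] (x : E) : 0 < jap x := by
  unfold jap; positivity

lemma one_le_jap {E : Type*} [NormedAddCommGroup E] (x : E) : 1 ≤ jap x := by
  unfold jap; rw [Real.one_le_sqrt]; nlinarith [sq_nonneg ‖x‖]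

lemma norm_le_jap {E : Type*} [NormedAddCommGroup E] (x : E) : ‖x‖ ≤ jap x := by
  unfold jap; apply Real.le_sqrt_of_sq_le; linarith

lemma jap_neg {E : Type*} [NormedAddCommGroup E] (x : E) : jap (-x) = jap x := by
  unfold jap; rw [norm_neg]

lemma jap_sub_comm {E : Type*} [NormedAddCommGroup E] (x y : E) : jap (x - y) = jap (y - x) := by
  rw [← jap_neg, neg_sub]

lemma jap_mono {E : Type*} [NormedAddCommGroup E] (x y : E) (h : ‖x‖ ≤ ‖y‖) : jap x ≤ jap y := by
  unfold jap; gcongr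

lemma jap_rpow_sq {E : Type*} [NormedAddCommGroup E] (x : E) (a : ℝ) :
    (jap x ^ (-a)) ^ 2 = jap x ^ (-(2 * a)) := by
  rw [← Real.rpow_natCast, ← Real.rpow_mul (jap_pos x).le]; congr 1; push_cast; ring

lemma jap_add_le {E : Type*} [NormedAddCommGroup E] (x y : E) :
    jap (x + y) ≤ 2 * max (jap x) (jap y) := by
  have key : ∀ u v : E, ‖u‖ ≤ ‖v‖ → jap (u + v) ≤ 2 * jap v := by
    intro u v h
    unfold jap
    rw [Real.sqrt_le_left (by positivity), mul_pow, Real.sq_sqrt (by positivity)]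
    have := norm_add_le u v
    nlinarith [norm_nonneg (u + v), norm_nonneg u, norm_nonneg v]
  rcases le_total ‖x‖ ‖y‖ with h | h
  · exact (key x y h).trans (by gcongr; exact le_max_right _ _)
  · rw [add_comm]
    exact (key y x h).trans (by gcongr; exact le_max_left _ _)

lemma measurable_jap {E : Type*} [NormedAddCommGroup E] [MeasurableSpace E] [BorelSpace E] :
    Measurable (jap : E → ℝ) := by
  unfold jap
  exact (by fun_prop : Continuous fun x : E => Real.sqrt (1 + ‖x‖ ^ 2)).measurable

lemma measurable_hfun {E : Type*} [NormedAddCommGroup E] [MeasurableSpace E] [BorelSpace E]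
    (γ k : ℝ) : Measurable (fun y : E => hfun γ ‖y‖ k) := by
  unfold hfun
  fun_prop

lemma sphere_step (m : ℕ) (ε : ℝ) (hε : 0 < ε) : ∃ C : ℝ, 0 ≤ C ∧
    ∀ b : ℝ, (m : ℝ) ≤ b → b ≤ m + 1 - ε → ∀ v : EE (2 * m + 2), ∀ r : ℝ, 0 < r →
      ENNReal.ofReal (r ^ (2 * m)) * ∫⁻ ω, ENNReal.ofReal (jap (r • (ω : EE (2 * m + 2)) - v) ^ (-(2 * b)))
        ∂(volume : Measure (EE (2 * m + 2))).toSphere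
      ≤ ENNReal.ofReal (C * Real.sqrt (1 + r ^ 2) ^ (-(2 * (b - m)))) := by
  obtain ⟨G, hG, hGb⟩ := sphere_G (n := 2 * m + 2) (2 * (m + 1 - ε)) (by push_cast; linarith)
  set σ := (volume : Measure (EE (2 * m + 2))).toSphere
  set D : ℝ≥0∞ := σ Set.univ + G with hD
  have hDtop : D ≠ ∞ := ENNReal.add_ne_top.2 ⟨measure_ne_top _ _, hG⟩
  refine ⟨D.toReal * 4, by positivity, ?_⟩
  intro b hb1 hb2 v r hr
  have hm0 : (0 : ℝ) ≤ m := Nat.cast_nonneg _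
  have aux : ∀ M : ℝ, 1 ≤ M → r ≤ M → M ^ (-(2 * (b - m))) ≤ 4 * Real.sqrt (1 + r ^ 2) ^ (-(2 * (b - m))) := by
    intro M hM hrM
    have hR : Real.sqrt (1 + r ^ 2) ≤ 2 * M := by
      rw [Real.sqrt_le_left (by positivity)]; nlinarith
    have h1 : (2 * M) ^ (-(2 * (b - m))) ≤ Real.sqrt (1 + r ^ 2) ^ (-(2 * (b - m))) :=
      Real.rpow_le_rpow_of_nonpos (by positivity) hR (by linarith)
    have h2 : (1 / 4 : ℝ) ≤ 2 ^ (-(2 * (b - m))) := by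
      calc (1 / 4 : ℝ) = 2 ^ (-2 : ℝ) := by
            rw [Real.rpow_neg (by norm_num)]; norm_num
        _ ≤ _ := Real.rpow_le_rpow_of_exponent_le (by norm_num) (by linarith)
    rw [Real.mul_rpow (by norm_num) (by positivity)] at h1
    have h3 : 0 < M ^ (-(2 * (b - m))) := by positivity
    nlinarith
  suffices H : ∃ M : ℝ, 1 ≤ M ∧ r ≤ M ∧ ENNReal.ofReal (r ^ (2 * m)) * ∫⁻ ω, ENNReal.ofReal (jap (r • (ω : EE (2 * m + 2)) - v) ^ (-(2 * b))) ∂σ ≤ D * ENNReal.ofReal (M ^ (-(2 * (b - m)))) by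
    obtain ⟨M, hM1, hM2, hM3⟩ := H
    refine hM3.trans ?_
    rw [mul_assoc, ENNReal.ofReal_mul ENNReal.toReal_nonneg, ENNReal.ofReal_toReal hDtop]
    exact mul_le_mul_right (ENNReal.ofReal_le_ofReal (aux M hM1 hM2)) _
  rcases le_total r 1 with h | h
  · refine ⟨1, le_rfl, h, ?_⟩
    rw [Real.one_rpow, ENNReal.ofReal_one, mul_one]
    calc _ ≤ 1 * ∫⁻ ω : Metric.sphere (0 : EE (2 * m + 2)) 1, 1 ∂σ := by
          gcongr with ω
          · rw [← ENNReal.ofReal_one]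
            exact ENNReal.ofReal_le_ofReal (pow_le_one₀ hr.le h)
          · rw [← ENNReal.ofReal_one]
            apply ENNReal.ofReal_le_ofReal
            exact Real.rpow_le_one_of_one_le_of_nonpos (one_le_jap _) (by linarith)
      _ ≤ D := by simp [hD]
  · refine ⟨r, h, le_rfl, ?_⟩
    have hpt : ∀ ω : Metric.sphere (0 : EE (2 * m + 2)) 1,
        ENNReal.ofReal (jap (r • (ω : EE (2 * m + 2)) - v) ^ (-(2 * b))) ≤
        ENNReal.ofReal (r ^ (-(2 * b))) * Gmaj (2 * (m + 1 - ε)) ‖(ω : EE (2 * m + 2)) - r⁻¹ • v‖ := by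
      intro ω
      set t := ‖(ω : EE (2 * m + 2)) - r⁻¹ • v‖
      have hu : 0 < max t r⁻¹ := lt_max_of_lt_right (by positivity)
      refine le_trans ?_ (mul_le_mul_right (le_Gmaj _ (2 * b) t (max t r⁻¹) (by linarith) (by linarith) (le_max_left _ _) hu) _)
      rw [← ENNReal.ofReal_mul (by positivity), ← Real.mul_rpow hr.le hu.le]
      apply ENNReal.ofReal_le_ofReal
      apply Real.rpow_le_rpow_of_nonpos (by positivity) _ (by linarith)
      rw [mul_max_of_nonneg _ _ hr.le, mul_inv_cancel₀ hr.ne']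
      refine max_le ?_ (one_le_jap _)
      refine le_trans (le_of_eq ?_) (norm_le_jap _)
      have : r • (ω : EE (2 * m + 2)) - v = r • ((ω : EE (2 * m + 2)) - r⁻¹ • v) := by
        rw [smul_sub, smul_smul, mul_inv_cancel₀ hr.ne', one_smul]
      rw [this, norm_smul, Real.norm_of_nonneg hr.le]
    calc _ ≤ ENNReal.ofReal (r ^ (2 * m)) * (ENNReal.ofReal (r ^ (-(2 * b))) * G) := by
          refine mul_le_mul_right ?_ _
          refine (lintegral_mono hpt).trans ?_
          rw [lintegral_const_mul' _ _ ENNReal.ofReal_ne_top]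
          exact mul_le_mul_right (hGb _) _
      _ = G * ENNReal.ofReal (r ^ (-(2 * (b - m)))) := by
          rw [← mul_assoc, ← ENNReal.ofReal_mul (by positivity), mul_comm, ← Real.rpow_natCast,
            ← Real.rpow_add hr]
          congr 3; push_cast; ring
      _ ≤ _ := mul_le_mul_left (by simp [hD]) _

lemma real_ineq (γ r k β : ℝ) (hγ : 0 < γ) (hr : 0 < r) (hk : 0 ≤ k) (hβ0 : 0 ≤ β) (hβ1 : β ≤ 1) :
    r ^ 2 * hfun γ r k ^ 2 * Real.sqrt (1 + r ^ 2) ^ (-(2 * β)) ≤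
      Real.sqrt (1 + k ^ 2) ^ (-(2 * β)) * (γ + |r - k|)⁻¹ ^ 2 := by
  set R := Real.sqrt (1 + r ^ 2) with hR
  set J := Real.sqrt (1 + k ^ 2) with hJ
  have hR1 : 1 ≤ R := by rw [hR, Real.one_le_sqrt]; nlinarith
  have hRr : r ≤ R := Real.le_sqrt_of_sq_le (by linarith)
  have hJk : J ≤ 1 + k := by rw [hJ, Real.sqrt_le_left (by positivity)]; nlinarith
  have hJ0 : 0 < J := by rw [hJ]; positivity
  have hR0 : 0 < R := by linarith
  set x := r / (r + k) with hx
  have hx0 : 0 < x := by positivity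
  have hx1 : x ≤ 1 := by rw [hx, div_le_one (by positivity)]; linarith
  have hxR : x ≤ R / J := by
    rw [hx, div_le_div_iff₀ (by positivity) hJ0]
    nlinarith
  have h1 : x ^ 2 ≤ (R / J) ^ (2 * β) := by
    calc x ^ 2 = x ^ (2 : ℝ) := by norm_num
      _ ≤ x ^ (2 * β) := Real.rpow_le_rpow_of_exponent_ge hx0 hx1 (by linarith)
      _ ≤ _ := Real.rpow_le_rpow hx0.le hxR (by linarith)
  have h2 : r * (γ + |r + k|)⁻¹ ≤ x := by
    rw [hx, abs_of_pos (by positivity), div_eq_mul_inv]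
    exact mul_le_mul_of_nonneg_left (inv_anti₀ (by positivity) (by linarith)) hr.le
  have h3 : (r * (γ + |r + k|)⁻¹) ^ 2 ≤ (R / J) ^ (2 * β) :=
    (pow_le_pow_left₀ (by positivity) h2 2).trans h1
  have hp : (R / J) ^ (2 * β) * R ^ (-(2 * β)) = J ^ (-(2 * β)) := by
    rw [Real.div_rpow hR0.le hJ0.le, Real.rpow_neg hR0.le, Real.rpow_neg hJ0.le]
    have : R ^ (2 * β) ≠ 0 := by positivity
    field_simp
  unfold hfun
  calc _ = (r * (γ + |r + k|)⁻¹) ^ 2 * R ^ (-(2 * β)) * (γ + |r - k|)⁻¹ ^ 2 := by ring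
    _ ≤ (R / J) ^ (2 * β) * R ^ (-(2 * β)) * (γ + |r - k|)⁻¹ ^ 2 := by gcongr
    _ = _ := by rw [hp]

lemma L_bound (m : ℕ) (ε : ℝ) (hε : 0 < ε) : ∃ C : ℝ, 0 ≤ C ∧
    ∀ b : ℝ, (m : ℝ) ≤ b → b ≤ m + 1 - ε → ∀ γ : ℝ, 0 < γ → ∀ ξ v : EE (2 * m + 2),
      ∫⁻ y, ENNReal.ofReal (hfun γ ‖y‖ ‖ξ‖ ^ 2 * jap (y - v) ^ (-(2 * b))) ≤
        ENNReal.ofReal (C * γ⁻¹ * jap ξ ^ (-(2 * (b - m)))) := by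
  obtain ⟨C, hC, hb⟩ := sphere_step m ε hε
  refine ⟨C * Real.pi, by positivity, ?_⟩
  intro b hb1 hb2 γ hγ ξ v
  have hmeas : Measurable fun y : EE (2 * m + 2) => ENNReal.ofReal (hfun γ ‖y‖ ‖ξ‖ ^ 2 * jap (y - v) ^ (-(2 * b))) := by
    apply ENNReal.measurable_ofReal.comp
    exact ((measurable_hfun γ _).pow_const 2).mul ((measurable_jap.comp (measurable_id.sub_const v)).pow_const _)
  rw [polar _ hmeas]
  have hJ : 0 ≤ jap ξ ^ (-(2 * (b - m))) := Real.rpow_nonneg (jap_pos _).le _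
  calc _ ≤ ∫⁻ r in Set.Ioi (0 : ℝ), ENNReal.ofReal (C * jap ξ ^ (-(2 * (b - m)))) * ENNReal.ofReal ((γ + |r - ‖ξ‖|)⁻¹ ^ 2) := by
        refine setLIntegral_mono' measurableSet_Ioi fun r hr => ?_
        have hr : 0 < r := hr
        have e1 : ∀ ω : Metric.sphere (0 : EE (2 * m + 2)) 1,
            ENNReal.ofReal (hfun γ ‖r • (ω : EE (2 * m + 2))‖ ‖ξ‖ ^ 2 * jap (r • (ω : EE (2 * m + 2)) - v) ^ (-(2 * b)))
            = ENNReal.ofReal (hfun γ r ‖ξ‖ ^ 2) * ENNReal.ofReal (jap (r • (ω : EE (2 * m + 2)) - v) ^ (-(2 * b))) := by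
          intro ω
          have hω : ‖(ω : EE (2 * m + 2))‖ = 1 := by simp
          rw [norm_smul, hω, mul_one, Real.norm_of_nonneg hr.le, ENNReal.ofReal_mul (by positivity)]
        simp_rw [e1]
        rw [lintegral_const_mul' _ _ ENNReal.ofReal_ne_top]
        rw [show r ^ (2 * m + 2) = r ^ 2 * r ^ (2 * m) by ring, ENNReal.ofReal_mul (by positivity)]
        calc _ = ENNReal.ofReal (r ^ 2) * ENNReal.ofReal (hfun γ r ‖ξ‖ ^ 2) * (ENNReal.ofReal (r ^ (2 * m)) *
              ∫⁻ ω, ENNReal.ofReal (jap (r • (ω : EE (2 * m + 2)) - v) ^ (-(2 * b)))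
                ∂(volume : Measure (EE (2 * m + 2))).toSphere) := by ring
          _ ≤ ENNReal.ofReal (r ^ 2) * ENNReal.ofReal (hfun γ r ‖ξ‖ ^ 2) * ENNReal.ofReal (C * Real.sqrt (1 + r ^ 2) ^ (-(2 * (b - m)))) :=
              mul_le_mul_right (hb b hb1 hb2 v r hr) _
          _ = ENNReal.ofReal (C * (r ^ 2 * hfun γ r ‖ξ‖ ^ 2 * Real.sqrt (1 + r ^ 2) ^ (-(2 * (b - m))))) := by
              rw [← ENNReal.ofReal_mul (by positivity), ← ENNReal.ofReal_mul (by positivity)]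
              congr 1; ring
          _ ≤ ENNReal.ofReal (C * (Real.sqrt (1 + ‖ξ‖ ^ 2) ^ (-(2 * (b - m))) * (γ + |r - ‖ξ‖|)⁻¹ ^ 2)) := by
              apply ENNReal.ofReal_le_ofReal
              exact mul_le_mul_of_nonneg_left (real_ineq γ r ‖ξ‖ (b - m) hγ hr (norm_nonneg _) (by linarith) (by linarith)) hC
          _ = _ := by
              rw [← ENNReal.ofReal_mul (by positivity)]
              congr 1
              rw [jap]; ring
    _ ≤ ∫⁻ r : ℝ, ENNReal.ofReal (C * jap ξ ^ (-(2 * (b - m)))) * ENNReal.ofReal ((γ + |r - ‖ξ‖|)⁻¹ ^ 2) :=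
        setLIntegral_le_lintegral _ _
    _ ≤ ENNReal.ofReal (C * jap ξ ^ (-(2 * (b - m)))) * ENNReal.ofReal (Real.pi * γ⁻¹) := by
        rw [lintegral_const_mul' _ _ ENNReal.ofReal_ne_top]
        exact mul_le_mul_right (oneD γ _ hγ) _
    _ = _ := by
        rw [← ENNReal.ofReal_mul (by positivity)]
        congr 1; ring

lemma split_ineq {E : Type*} [NormedAddCommGroup E] (m : ℕ) (ε a b : ℝ) (hε : 0 < ε)
    (ha1 : (m : ℝ) ≤ a) (ha2 : a ≤ m + 1 - ε) (hb1 : (m : ℝ) ≤ b) (hb2 : b ≤ m + 1 - ε) (ξ y z : E) :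
    jap (y + ξ) ^ (-(2 * a)) * jap (z - y) ^ (-(2 * b)) ≤
      2 ^ (2 * (m + 1)) * (jap (z + ξ) ^ (-(2 * a)) * jap (y - z) ^ (-(2 * b)) +
        jap (z + ξ) ^ (-(2 * b)) * jap (y - -ξ) ^ (-(2 * a))) := by
  have hm0 : (0 : ℝ) ≤ m := Nat.cast_nonneg _
  rw [sub_neg_eq_add, jap_sub_comm y z]
  have hle := jap_add_le (z - y) (y + ξ)
  rw [show z - y + (y + ξ) = z + ξ by abel] at hle
  have p1 := jap_pos (y + ξ)
  have p2 := jap_pos (z - y)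
  have p3 := jap_pos (z + ξ)
  set X := jap (y + ξ)
  set Y := jap (z - y)
  set D := jap (z + ξ)
  have aux : ∀ c W : ℝ, 0 ≤ c → c ≤ m + 1 → 0 < W → D ≤ 2 * W →
      W ^ (-(2 * c)) ≤ 2 ^ (2 * (m + 1)) * D ^ (-(2 * c)) := by
    intro c W hc0 hc1 hW hDW
    have h1 : (2 * W) ^ (-(2 * c)) ≤ D ^ (-(2 * c)) :=
      Real.rpow_le_rpow_of_nonpos p3 hDW (by linarith)
    rw [Real.mul_rpow (by norm_num) hW.le] at h1
    calc W ^ (-(2 * c)) = 2 ^ (2 * c) * (2 ^ (-(2 * c)) * W ^ (-(2 * c))) := by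
          rw [← mul_assoc, ← Real.rpow_add (by norm_num)]; simp
      _ ≤ 2 ^ (2 * c) * D ^ (-(2 * c)) := by gcongr
      _ ≤ 2 ^ (2 * (m + 1)) * D ^ (-(2 * c)) := by
          gcongr
          rw [← Real.rpow_natCast]
          apply Real.rpow_le_rpow_of_exponent_le (by norm_num)
          push_cast; linarith
  have q1 : 0 ≤ X ^ (-(2 * a)) := by positivity
  have q2 : 0 ≤ Y ^ (-(2 * b)) := by positivity
  have q3 : 0 ≤ D ^ (-(2 * a)) := by positivity
  have q4 : 0 ≤ D ^ (-(2 * b)) := by positivity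
  have q5 : (0 : ℝ) ≤ 2 ^ (2 * (m + 1)) := by positivity
  rcases le_total X Y with h | h
  · rw [max_eq_left h] at hle
    have := aux b Y (by linarith) (by linarith) p2 hle
    calc _ ≤ X ^ (-(2 * a)) * (2 ^ (2 * (m + 1)) * D ^ (-(2 * b))) := by gcongr
      _ ≤ _ := by nlinarith [mul_nonneg q5 (mul_nonneg q3 q2)]
  · rw [max_eq_right h] at hle
    have := aux a X (by linarith) (by linarith) p1 hle
    calc _ ≤ (2 ^ (2 * (m + 1)) * D ^ (-(2 * a))) * Y ^ (-(2 * b)) := by gcongr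
      _ ≤ _ := by nlinarith [mul_nonneg q5 (mul_nonneg q4 q1)]

lemma step_bound (m : ℕ) (ε : ℝ) (hε : 0 < ε) : ∃ C : ℝ, 0 ≤ C ∧
    ∀ a b : ℝ, (m : ℝ) ≤ a → a ≤ m + 1 - ε → (m : ℝ) ≤ b → b ≤ m + 1 - ε →
      ∀ γ : ℝ, 0 < γ → ∀ ξ z : EE (2 * m + 2),
      ∫⁻ y, ENNReal.ofReal (hfun γ ‖y‖ ‖ξ‖ ^ 2 * (jap (y + ξ) ^ (-(2 * a)) * jap (z - y) ^ (-(2 * b)))) ≤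
        ENNReal.ofReal (C * γ⁻¹ * (jap ξ ^ (-(2 * (b - m))) * jap (z + ξ) ^ (-(2 * a)) +
          jap ξ ^ (-(2 * (a - m))) * jap (z + ξ) ^ (-(2 * b)))) := by
  obtain ⟨C, hC, hL⟩ := L_bound m ε hε
  refine ⟨2 ^ (2 * (m + 1)) * C, by positivity, ?_⟩
  intro a b ha1 ha2 hb1 hb2 γ hγ ξ z
  have hnn : ∀ (x : EE (2 * m + 2)) (c : ℝ), 0 ≤ jap x ^ c := fun x c => Real.rpow_nonneg (jap_pos x).le _
  have hmeas : ∀ (v : EE (2 * m + 2)) (c : ℝ), Measurable fun y : EE (2 * m + 2) => ENNReal.ofReal (hfun γ ‖y‖ ‖ξ‖ ^ 2 * jap (y - v) ^ (-(2 * c))) := by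
    intro v c
    apply ENNReal.measurable_ofReal.comp
    exact ((measurable_hfun γ _).pow_const 2).mul ((measurable_jap.comp (measurable_id.sub_const v)).pow_const _)
  set A : ℝ := 2 ^ (2 * (m + 1)) with hA
  have hA0 : 0 ≤ A := by positivity
  calc _ ≤ ∫⁻ y, (ENNReal.ofReal (A * jap (z + ξ) ^ (-(2 * a))) * ENNReal.ofReal (hfun γ ‖y‖ ‖ξ‖ ^ 2 * jap (y - z) ^ (-(2 * b))) +
          ENNReal.ofReal (A * jap (z + ξ) ^ (-(2 * b))) * ENNReal.ofReal (hfun γ ‖y‖ ‖ξ‖ ^ 2 * jap (y - -ξ) ^ (-(2 * a)))) := by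
        refine lintegral_mono fun y => ?_
        have n1 := hnn (z + ξ) (-(2 * a))
        have n2 := hnn (z + ξ) (-(2 * b))
        have n3 := hnn (y - z) (-(2 * b))
        have n4 := hnn (y - -ξ) (-(2 * a))
        rw [← ENNReal.ofReal_mul (by positivity), ← ENNReal.ofReal_mul (by positivity),
          ← ENNReal.ofReal_add (by positivity) (by positivity)]
        apply ENNReal.ofReal_le_ofReal
        calc _ ≤ hfun γ ‖y‖ ‖ξ‖ ^ 2 * _ :=
              mul_le_mul_of_nonneg_left (split_ineq m ε a b hε ha1 ha2 hb1 hb2 ξ y z) (sq_nonneg _)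
          _ = _ := by rw [← hA]; ring
    _ = ENNReal.ofReal (A * jap (z + ξ) ^ (-(2 * a))) * (∫⁻ y, ENNReal.ofReal (hfun γ ‖y‖ ‖ξ‖ ^ 2 * jap (y - z) ^ (-(2 * b)))) +
          ENNReal.ofReal (A * jap (z + ξ) ^ (-(2 * b))) * (∫⁻ y, ENNReal.ofReal (hfun γ ‖y‖ ‖ξ‖ ^ 2 * jap (y - -ξ) ^ (-(2 * a)))) := by
        rw [lintegral_add_left ((hmeas z b).const_mul _), lintegral_const_mul' _ _ ENNReal.ofReal_ne_top,
          lintegral_const_mul' _ _ ENNReal.ofReal_ne_top]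
    _ ≤ ENNReal.ofReal (A * jap (z + ξ) ^ (-(2 * a))) * ENNReal.ofReal (C * γ⁻¹ * jap ξ ^ (-(2 * (b - m)))) +
          ENNReal.ofReal (A * jap (z + ξ) ^ (-(2 * b))) * ENNReal.ofReal (C * γ⁻¹ * jap ξ ^ (-(2 * (a - m)))) :=
        add_le_add (mul_le_mul_right (hL b hb1 hb2 γ hγ ξ z) _) (mul_le_mul_right (hL a ha1 ha2 γ hγ ξ (-ξ)) _)
    _ = _ := by
        have n1 := hnn (z + ξ) (-(2 * a))
        have n2 := hnn (z + ξ) (-(2 * b))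
        have n3 := hnn ξ (-(2 * (b - m)))
        have n4 := hnn ξ (-(2 * (a - m)))
        rw [← ENNReal.ofReal_mul (by positivity), ← ENNReal.ofReal_mul (by positivity),
          ← ENNReal.ofReal_add (by positivity) (by positivity)]
        congr 1; ring

/-- extension of a finite tuple by the constant `ξ` -/
def extT {E : Type*} (k : ℕ) (ξ : E) (y : Fin k → E) : ℕ → E :=
  fun j => if h : j < k then y ⟨j, h⟩ else ξ

lemma extT_cons_zero {E : Type*} (k : ℕ) (ξ : E) (y0 : E) (y : Fin k → E) :
    extT (k + 1) ξ (Fin.cons y0 y : Fin (k + 1) → E) 0 = y0 := by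
  simp [extT]

lemma extT_cons_succ {E : Type*} (k : ℕ) (ξ : E) (y0 : E) (y : Fin k → E) (j : ℕ) :
    extT (k + 1) ξ (Fin.cons y0 y : Fin (k + 1) → E) (j + 1) = extT k ξ y j := by
  unfold extT
  by_cases h : j < k
  · rw [dif_pos h, dif_pos (by omega)]
    exact Fin.cons_succ (α := fun _ => E) y0 y ⟨j, h⟩
  · rw [dif_neg h, dif_neg (by omega)]

lemma extT_self {E : Type*} (k : ℕ) (ξ : E) (y : Fin k → E) : extT k ξ y k = ξ := by
  simp [extT]

/-- tail product -/
noncomputable def Ptail {E : Type*} [NormedAddCommGroup E] (k : ℕ) (s : ℕ → ℝ) (z : ℕ → E) : ℝ :=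
  ∏ j ∈ Finset.Ico 1 (k + 1), jap (z j - z (j - 1)) ^ (-(s (j + 1)))

lemma Mfun_cons {E : Type*} [NormedAddCommGroup E] (k : ℕ) (s : ℕ → ℝ) (ξ y0 : E) (y : Fin k → E) :
    Mfun (k + 1 + 1) s (extT (k + 1) ξ (Fin.cons y0 y : Fin (k + 1) → E)) =
      jap (y0 + ξ) ^ (-(s 0)) * (jap (extT k ξ y 0 - y0) ^ (-(s 1)) * Ptail k s (extT k ξ y)) := by
  unfold Mfun Ptail
  rw [Nat.add_sub_cancel, extT_self, extT_cons_zero, Finset.prod_eq_prod_Ico_succ_bot (by omega)]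
  congr 2
  · rw [Nat.sub_self, extT_cons_zero]
    have := extT_cons_succ k ξ y0 y 0
    rw [zero_add] at this
    rw [this]
  · rw [← Finset.prod_Ico_add' _ 1 (k + 1) 1]
    refine Finset.prod_congr rfl fun j hj => ?_
    rw [Finset.mem_Ico] at hj
    obtain ⟨i, rfl⟩ : ∃ i, j = i + 1 := ⟨j - 1, by omega⟩
    rw [extT_cons_succ, Nat.add_sub_cancel, Nat.add_sub_cancel, extT_cons_succ]

lemma Mfun_tail {E : Type*} [NormedAddCommGroup E] (k : ℕ) (s s' : ℕ → ℝ) (ξ : E) (y : Fin k → E)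
    (hs : ∀ j, 1 ≤ j → s' j = s (j + 1)) :
    Mfun (k + 1) s' (extT k ξ y) = jap (extT k ξ y 0 + ξ) ^ (-(s' 0)) * Ptail k s (extT k ξ y) := by
  unfold Mfun Ptail
  rw [Nat.add_sub_cancel, extT_self]
  congr 1
  refine Finset.prod_congr rfl fun j hj => ?_
  rw [hs j (Finset.mem_Ico.1 hj).1]

lemma measurable_extT {E : Type*} [MeasurableSpace E] (k : ℕ) (ξ : E) (j : ℕ) :
    Measurable fun y : Fin k → E => extT k ξ y j := by
  unfold extT
  split_ifs with h
  · exact measurable_pi_apply _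
  · exact measurable_const

/-- the integrand -/
noncomputable def integrandT {E : Type*} [NormedAddCommGroup E] (k : ℕ) (γ : ℝ) (ξ : E) (s : ℕ → ℝ)
    (y : Fin k → E) : ℝ :=
  (∏ j : Fin k, hfun γ ‖y j‖ ‖ξ‖) ^ 2 * Mfun (k + 1) s (extT k ξ y) ^ 2

lemma measurable_integrandT (d k : ℕ) (γ : ℝ) (ξ : EE d) (s : ℕ → ℝ) :
    Measurable (integrandT k γ ξ s) := by
  unfold integrandT Mfun
  refine Measurable.mul (Measurable.pow_const ?_ 2) (Measurable.pow_const (Measurable.mul ?_ ?_) 2)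
  · exact Finset.measurable_fun_prod _ fun j _ => (measurable_hfun γ ‖ξ‖).comp (measurable_pi_apply j)
  · exact (measurable_jap.comp ((measurable_extT k ξ _).add (measurable_extT k ξ _))).pow_const _
  · exact Finset.measurable_fun_prod _ fun j _ =>
      (measurable_jap.comp ((measurable_extT k ξ _).sub (measurable_extT k ξ _))).pow_const _

lemma lintegral_cons (d k : ℕ) (F : (Fin (k + 1) → EE d) → ℝ≥0∞) (hF : Measurable F) :
    ∫⁻ y, F y = ∫⁻ y : Fin k → EE d, ∫⁻ y0 : EE d, F (Fin.cons y0 y : Fin (k + 1) → EE d) := by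
  have hmp := (volume_preserving_piFinSuccAbove (fun _ : Fin (k + 1) => EE d) 0).symm
  rw [← hmp.lintegral_comp_emb (MeasurableEquiv.measurableEmbedding _), Measure.volume_eq_prod,
    lintegral_prod_symm _ (Measurable.aemeasurable (hF.fun_comp (MeasurableEquiv.measurable _)))]
  refine lintegral_congr fun y => lintegral_congr fun y0 => ?_
  congr 1
  simp only [MeasurableEquiv.piFinSuccAbove_symm_apply, Fin.insertNthEquiv, Equiv.coe_fn_mk]
  simp

lemma main_induction (m : ℕ) (ε : ℝ) (hε : 0 < ε) : ∃ C : ℝ, 0 ≤ C ∧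
    ∀ k : ℕ, ∀ s : ℕ → ℝ, (∀ j, j < k + 1 → (m : ℝ) ≤ s j ∧ s j ≤ (m : ℝ) + 1 - ε) →
      ∀ γ : ℝ, 0 < γ → ∀ ξ : EE (2 * m + 2),
      ∫⁻ y, ENNReal.ofReal (integrandT k γ ξ s y) ≤
        ENNReal.ofReal (C ^ k * (γ ^ k)⁻¹ * jap ξ ^ (2 * ((k : ℝ) * m - ∑ j ∈ Finset.range (k + 1), s j))) := by
  obtain ⟨C, hC, hstep⟩ := step_bound m ε hε
  refine ⟨2 * C, by positivity, ?_⟩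
  intro k
  induction k with
  | zero =>
    intro s hs γ hγ ξ
    have hm0 : (0 : ℝ) ≤ m := Nat.cast_nonneg _
    have hs0 := (hs 0 (by omega)).1
    have h1 : ∀ y : Fin 0 → EE (2 * m + 2), integrandT 0 γ ξ s y = jap (ξ + ξ) ^ (-(2 * s 0)) := by
      intro y
      simp [integrandT, Mfun, extT, jap_rpow_sq]
    have h2 : jap (ξ + ξ) ^ (-(2 * s 0)) ≤ jap ξ ^ (-(2 * s 0)) := by
      apply Real.rpow_le_rpow_of_nonpos (jap_pos _) _ (by linarith)
      apply jap_mono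
      rw [← two_smul ℝ ξ, norm_smul]
      simp only [Real.norm_ofNat]
      linarith [norm_nonneg ξ]
    simp_rw [h1]
    rw [lintegral_const]
    have hv : (volume : Measure (Fin 0 → EE (2 * m + 2))) Set.univ = 1 := by
      simp [volume_pi]
    rw [hv, mul_one]
    apply ENNReal.ofReal_le_ofReal
    simpa using h2
  | succ k ih =>
    intro s hs γ hγ ξ
    have hnn : ∀ (x : EE (2 * m + 2)) (c : ℝ), 0 ≤ jap x ^ c := fun x c => Real.rpow_nonneg (jap_pos x).le _
    set s1 : ℕ → ℝ := fun j => if j = 0 then s 0 else s (j + 1) with hs1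
    set s2 : ℕ → ℝ := fun j => s (j + 1) with hs2
    have hr0 := hs 0 (by omega)
    have hr1 := hs 1 (by omega)
    have ih1 := ih s1 (by
      intro j hj
      by_cases h : j = 0
      · simpa [hs1, h] using hr0
      · simpa [hs1, h] using hs (j + 1) (by omega)) γ hγ ξ
    have ih2 := ih s2 (fun j hj => hs (j + 1) (by omega)) γ hγ ξ
    have hsum2 : ∑ j ∈ Finset.range (k + 1 + 1), s j = s 0 + ∑ j ∈ Finset.range (k + 1), s2 j := by
      rw [Finset.sum_range_succ' s (k + 1), add_comm]
    have hsum1 : ∑ j ∈ Finset.range (k + 1 + 1), s j = s 1 + ∑ j ∈ Finset.range (k + 1), s1 j := by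
      rw [hsum2, Finset.sum_range_succ' s2 k, Finset.sum_range_succ' s1 k]
      have : ∑ j ∈ Finset.range k, s1 (j + 1) = ∑ j ∈ Finset.range k, s2 (j + 1) :=
        Finset.sum_congr rfl fun j _ => by simp [hs1, hs2]
      rw [this]
      simp only [hs1, hs2, if_true]
      ring
    set K : ℝ := C * γ⁻¹ with hK
    have hK0 : 0 ≤ K := by positivity
    have hinner : ∀ y : Fin k → EE (2 * m + 2),
        ∫⁻ y0, ENNReal.ofReal (integrandT (k + 1) γ ξ s (Fin.cons y0 y : Fin (k + 1) → EE (2 * m + 2))) ≤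
          ENNReal.ofReal (K * jap ξ ^ (-(2 * (s 1 - m)))) * ENNReal.ofReal (integrandT k γ ξ s1 y) +
          ENNReal.ofReal (K * jap ξ ^ (-(2 * (s 0 - m)))) * ENNReal.ofReal (integrandT k γ ξ s2 y) := by
      intro y
      set z := extT k ξ y with hz
      set Q : ℝ := (∏ j : Fin k, hfun γ ‖y j‖ ‖ξ‖) ^ 2 * Ptail k s z ^ 2 with hQ
      have hQ0 : 0 ≤ Q := by positivity
      have e0 : ∀ y0, ENNReal.ofReal (integrandT (k + 1) γ ξ s (Fin.cons y0 y : Fin (k + 1) → EE (2 * m + 2))) =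
          ENNReal.ofReal Q * ENNReal.ofReal (hfun γ ‖y0‖ ‖ξ‖ ^ 2 * (jap (y0 + ξ) ^ (-(2 * s 0)) * jap (z 0 - y0) ^ (-(2 * s 1)))) := by
        intro y0
        rw [← ENNReal.ofReal_mul hQ0]
        congr 1
        unfold integrandT
        rw [Mfun_cons, Fin.prod_univ_succ, ← jap_rpow_sq, ← jap_rpow_sq]
        simp only [Fin.cons_zero, Fin.cons_succ]
        rw [hQ, ← hz]; ring
      have e1 : integrandT k γ ξ s1 y = Q * jap (z 0 + ξ) ^ (-(2 * s 0)) := by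
        unfold integrandT
        rw [Mfun_tail k s s1 ξ y (fun j hj => by simp [hs1, show j ≠ 0 by omega]), ← jap_rpow_sq, hQ, ← hz]
        simp only [hs1, if_true]
        ring
      have e2 : integrandT k γ ξ s2 y = Q * jap (z 0 + ξ) ^ (-(2 * s 1)) := by
        unfold integrandT
        rw [Mfun_tail k s s2 ξ y (fun j hj => rfl), ← jap_rpow_sq, hQ, ← hz]
        simp only [hs2, zero_add]
        ring
      simp_rw [e0]
      rw [lintegral_const_mul' _ _ ENNReal.ofReal_ne_top]
      refine (mul_le_mul_right (hstep (s 0) (s 1) hr0.1 hr0.2 hr1.1 hr1.2 γ hγ ξ (z 0)) _).trans (le_of_eq ?_)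
      have n1 := hnn (z 0 + ξ) (-(2 * s 0))
      have n2 := hnn (z 0 + ξ) (-(2 * s 1))
      have n3 := hnn ξ (-(2 * (s 0 - m)))
      have n4 := hnn ξ (-(2 * (s 1 - m)))
      rw [e1, e2, ← ENNReal.ofReal_mul (by positivity), ← ENNReal.ofReal_mul (by positivity),
        ← ENNReal.ofReal_mul (by positivity), ← ENNReal.ofReal_add (by positivity) (by positivity)]
      congr 1; ring
    rw [lintegral_cons _ _ _ ((measurable_integrandT _ _ _ _ _).ennreal_ofReal)]
    refine (lintegral_mono hinner).trans ?_
    rw [lintegral_add_left (((measurable_integrandT _ _ _ _ _).ennreal_ofReal).const_mul _),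
      lintegral_const_mul' _ _ ENNReal.ofReal_ne_top, lintegral_const_mul' _ _ ENNReal.ofReal_ne_top]
    refine (add_le_add (mul_le_mul_right ih1 _) (mul_le_mul_right ih2 _)).trans (le_of_eq ?_)
    have n1 := hnn ξ (2 * ((k : ℝ) * m - ∑ j ∈ Finset.range (k + 1), s1 j))
    have n2 := hnn ξ (2 * ((k : ℝ) * m - ∑ j ∈ Finset.range (k + 1), s2 j))
    have n3 := hnn ξ (-(2 * (s 0 - m)))
    have n4 := hnn ξ (-(2 * (s 1 - m)))
    rw [← ENNReal.ofReal_mul (by positivity), ← ENNReal.ofReal_mul (by positivity),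
        ← ENNReal.ofReal_add (by positivity) (by positivity)]
    congr 1
    have f1 : jap ξ ^ (-(2 * (s 1 - m))) * jap ξ ^ (2 * ((k : ℝ) * m - ∑ j ∈ Finset.range (k + 1), s1 j)) =
        jap ξ ^ (2 * (((k + 1 : ℕ) : ℝ) * m - ∑ j ∈ Finset.range (k + 1 + 1), s j)) := by
      rw [← Real.rpow_add (jap_pos _), hsum1]; congr 1; push_cast; ring
    have f2 : jap ξ ^ (-(2 * (s 0 - m))) * jap ξ ^ (2 * ((k : ℝ) * m - ∑ j ∈ Finset.range (k + 1), s2 j)) =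
        jap ξ ^ (2 * (((k + 1 : ℕ) : ℝ) * m - ∑ j ∈ Finset.range (k + 1 + 1), s j)) := by
      rw [← Real.rpow_add (jap_pos _), hsum2]; congr 1; push_cast; ring
    calc _ = K * ((2 * C) ^ k * (γ ^ k)⁻¹) * (jap ξ ^ (-(2 * (s 1 - m))) * jap ξ ^ (2 * ((k : ℝ) * m - ∑ j ∈ Finset.range (k + 1), s1 j)))
          + K * ((2 * C) ^ k * (γ ^ k)⁻¹) * (jap ξ ^ (-(2 * (s 0 - m))) * jap ξ ^ (2 * ((k : ℝ) * m - ∑ j ∈ Finset.range (k + 1), s2 j))) := by ring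
      _ = _ := by
        rw [f1, f2, hK, pow_succ, pow_succ, mul_inv]; ring

theorem stmt_18 (n m : ℕ) (hn : n = 2 * m + 3) (ε : ℝ) (hε : 0 < ε) (hε1 : ε < 1) :
    ∃ C : ℝ, ∀ N : ℕ, 2 ≤ N → ∀ s : ℕ → ℝ,
      (∀ j, j < N → (m : ℝ) ≤ s j ∧ s j ≤ (m : ℝ) + 1 - ε) →
      ∀ γ : ℝ, 0 < γ → ∀ ξ : EuclideanSpace ℝ (Fin n),
        Tfun n N γ ξ s ≤
          C ^ (N - 1) * (γ ^ (N - 1))⁻¹ *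
            jap ξ ^ (2 * (((N : ℝ) - 1) * (m : ℝ) - ∑ j ∈ Finset.range N, s j)) := by
  subst hn
  obtain ⟨C, hC, h⟩ := main_induction m ε hε
  refine ⟨C, ?_⟩
  intro N hN s hs γ hγ ξ
  obtain ⟨k, rfl⟩ : ∃ k, N = k + 1 := ⟨N - 1, by omega⟩
  have hk := h k s hs γ hγ ξ
  have e : Tfun (2 * m + 3) (k + 1) γ ξ s = ∫ y, integrandT k γ (ξ : EE (2 * m + 2)) s y := rfl
  have hnn : 0 ≤ jap ξ ^ (2 * ((k : ℝ) * m - ∑ j ∈ Finset.range (k + 1), s j)) :=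
    Real.rpow_nonneg (jap_pos _).le _
  rw [e, integral_eq_lintegral_of_nonneg_ae
    (Filter.Eventually.of_forall fun y => by unfold integrandT; positivity)
    (measurable_integrandT _ _ _ _ _).aestronglyMeasurable]
  have ec : ((k + 1 : ℕ) : ℝ) - 1 = k := by push_cast; ring
  rw [ec, Nat.add_sub_cancel]
  exact ENNReal.toReal_le_of_le_ofReal (by positivity) hk
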